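/- There is an absolute constant K such that for every closed disk D of radius r > 1 in the plane, the number of lattice points lying on the boundary of the convex hull of D ∩ ℤ² is at most K·r^{2/3}. -/

import Mathlib

/-- The embedding of the integer lattice `ℤ × ℤ` into the Euclidean plane. -/
noncomputable def latticeEmbed (z : ℤ × ℤ) : EuclideanSpace ℝ (Fin 2) :=
  (EuclideanSpace.equiv (Fin 2) ℝ).symm ![(z.1 : ℝ), (z.2 : ℝ)]

namespace DiscHull

/-- Lattice point in the disk. -/
def InD (o1 o2 r : ℝ) (z : ℤ × ℤ) : Prop := ((z.1:ℝ) - o1)^2 + ((z.2:ℝ) - o2)^2 ≤ r^2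

/-- Lattice points of the disk having a supporting normal in the first quadrant. -/
def SQ (o1 o2 r : ℝ) : Set (ℤ × ℤ) :=
  {z | InD o1 o2 r z ∧ ∃ p q : ℝ, 0 ≤ p ∧ 0 ≤ q ∧ 0 < p + q ∧
    ∀ x : ℤ × ℤ, InD o1 o2 r x → p * ((x.1:ℝ) - z.1) + q * ((x.2:ℝ) - z.2) ≤ 0}

lemma chain {o1 o2 r : ℝ} {z w : ℤ × ℤ} (hz : z ∈ SQ o1 o2 r) (hw : w ∈ SQ o1 o2 r)
    (h : z.1 - z.2 ≤ w.1 - w.2) : z.1 ≤ w.1 ∧ w.2 ≤ z.2 := by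
  obtain ⟨hzD, p, q, hp, hq, hpq, H⟩ := hz
  obtain ⟨hwD, p', q', hp', hq', hpq', H'⟩ := hw
  constructor
  · by_contra hc
    push Not at hc
    have h2 : w.2 < z.2 := by omega
    have := H' z hzD
    have h3 : (1:ℝ) ≤ (z.1:ℝ) - w.1 := by
      have : w.1 + 1 ≤ z.1 := hc
      have : ((w.1 + 1 : ℤ):ℝ) ≤ z.1 := by exact_mod_cast this
      push_cast at this; linarith
    have h4 : (1:ℝ) ≤ (z.2:ℝ) - w.2 := by
      have : w.2 + 1 ≤ z.2 := h2
      have : ((w.2 + 1 : ℤ):ℝ) ≤ z.2 := by exact_mod_cast this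
      push_cast at this; linarith
    nlinarith
  · by_contra hc
    push Not at hc
    have h2 : z.1 < w.1 := by omega
    have := H w hwD
    have h3 : (1:ℝ) ≤ (w.1:ℝ) - z.1 := by
      have : z.1 + 1 ≤ w.1 := h2
      have : ((z.1 + 1 : ℤ):ℝ) ≤ w.1 := by exact_mod_cast this
      push_cast at this; linarith
    have h4 : (1:ℝ) ≤ (w.2:ℝ) - z.2 := by
      have : z.2 + 1 ≤ w.2 := hc
      have : ((z.2 + 1 : ℤ):ℝ) ≤ w.2 := by exact_mod_cast this
      push_cast at this; linarith
    nlinarith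

lemma real_aux {a b c d p q : ℝ} (ha : 0 ≤ a) (hc : 0 ≤ c) (hd : 0 ≤ d)
    (hq : 0 ≤ q) (hpq : 0 < p + q) (h1 : q * b ≤ p * a) (h2 : p * c ≤ q * d) :
    b * c ≤ a * d := by
  by_contra hlt
  push Not at hlt
  have h3 : q * b * c ≤ p * a * c := mul_le_mul_of_nonneg_right h1 hc
  have h4 : p * c * a ≤ q * d * a := mul_le_mul_of_nonneg_right h2 ha
  have h5 : q * (b * c - a * d) ≤ 0 := by nlinarith
  have hq0 : q = 0 := by
    by_contra hne
    have : 0 < q := lt_of_le_of_ne hq (Ne.symm hne)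
    nlinarith [mul_pos this (sub_pos.2 hlt)]
  subst hq0
  have hc0 : c = 0 := by
    have : 0 < p := by linarith
    by_contra hne
    have h6 : 0 < c := lt_of_le_of_ne hc (Ne.symm hne)
    nlinarith [mul_pos this h6]
  subst hc0
  nlinarith [mul_nonneg ha hd]

lemma line {o1 o2 r : ℝ} {z w : ℤ × ℤ} {a b : ℕ}
    (hz : z ∈ SQ o1 o2 r) (hz' : (z.1 + a, z.2 - b) ∈ SQ o1 o2 r)
    (hw : w ∈ SQ o1 o2 r) (hw' : (w.1 + a, w.2 - b) ∈ SQ o1 o2 r)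
    (h : z.1 - z.2 ≤ w.1 - w.2) : (b:ℤ) * (w.1 - z.1) = a * (z.2 - w.2) := by
  obtain ⟨hc, hd⟩ := chain hz hw h
  have hc' : (0:ℝ) ≤ (w.1:ℝ) - z.1 := by
    have : (z.1:ℝ) ≤ w.1 := by exact_mod_cast hc
    linarith
  have hd' : (0:ℝ) ≤ (z.2:ℝ) - w.2 := by
    have : (w.2:ℝ) ≤ z.2 := by exact_mod_cast hd
    linarith
  obtain ⟨-, p, q, hp, hq, hpq, H⟩ := hz'
  obtain ⟨-, p', q', hp', hq', hpq', H'⟩ := id hw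
  have e1 := H z hz.1
  have e2 := H _ hw'.1
  have e3 := H' z hz.1
  have e4 := H' _ hw'.1
  push_cast at e1 e2 e3 e4
  have ha : (0:ℝ) ≤ a := by positivity
  have hb : (0:ℝ) ≤ b := by positivity
  have l1 : (b:ℝ) * ((w.1:ℝ) - z.1) ≤ a * ((z.2:ℝ) - w.2) :=
    real_aux ha hc' hd' hq hpq (by nlinarith) (by nlinarith)
  have l2 : (a:ℝ) * ((z.2:ℝ) - w.2) ≤ b * ((w.1:ℝ) - z.1) :=
    real_aux hb hd' hc' hp' (by linarith) (by nlinarith) (by nlinarith)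
  have := le_antisymm l1 l2
  exact_mod_cast this

/-- Three collinear points: the middle one is supported by the normal of the line. -/
lemma support {o1 o2 r : ℝ} {w : ℤ × ℤ} {a b : ℕ} {t : ℝ} (ht : 0 < t) (hab : 0 < a + b)
    {z : ℤ × ℤ} (hz : InD o1 o2 r z) (hw : w ∈ SQ o1 o2 r) 
    (hw' : InD o1 o2 r (w.1 + a, w.2 - b))
    (h1 : (w.1:ℝ) - z.1 = t * a) (h2 : (z.2:ℝ) - w.2 = t * b) (x : ℤ × ℤ)
    (hx : InD o1 o2 r x) : (b:ℤ) * (x.1 - w.1) + a * (x.2 - w.2) ≤ 0 := by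
  obtain ⟨-, p, q, hp, hq, hpq, H⟩ := hw
  have e1 := H z hz
  have e2 := H _ hw'
  have e3 := H x hx
  push_cast at e2
  have ha : (0:ℝ) ≤ a := by positivity
  have hb : (0:ℝ) ≤ b := by positivity
  have hab' : (0:ℝ) < a + b := by exact_mod_cast hab
  have e4 : p * a = q * b := by
    apply le_antisymm
    · nlinarith
    · have : t * (q * b) ≤ t * (p * a) := by
        have : (z.1:ℝ) - w.1 = - (t * a) := by linarith
        rw [this, h2] at e1
        nlinarith
      exact le_of_mul_le_mul_left this ht
  -- (p,q) (a+b) = (p+q) (b,a)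
  have e5 : p * (a + b) = (p + q) * b := by linarith
  have e6 : q * (a + b) = (p + q) * a := by linarith
  have e7 : (p + q) * (b * ((x.1:ℝ) - w.1) + a * ((x.2:ℝ) - w.2)) ≤ 0 := by
    have : (p + q) * (b * ((x.1:ℝ) - w.1) + a * ((x.2:ℝ) - w.2))
      = (a + b) * (p * ((x.1:ℝ) - w.1) + q * ((x.2:ℝ) - w.2)) := by
      linear_combination (-((x.1:ℝ) - w.1)) * e5 - ((x.2:ℝ) - w.2) * e6
    rw [this]
    exact mul_nonpos_of_nonneg_of_nonpos hab'.le e3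
  have e8 : b * ((x.1:ℝ) - w.1) + a * ((x.2:ℝ) - w.2) ≤ 0 := by
    by_contra hcon
    push Not at hcon
    nlinarith [mul_pos hpq hcon]
  exact_mod_cast e8

lemma chord {o1 o2 r : ℝ} (hr : 0 ≤ r) {P : ℤ × ℤ} {a b : ℕ} (hg : Nat.gcd a b = 1) {k : ℕ}
    (hP : InD o1 o2 r P) (hQ : InD o1 o2 r (P.1 + k * a, P.2 - k * b))
    (hs : ∀ x, InD o1 o2 r x → (b:ℤ) * (x.1 - P.1) + a * (x.2 - P.2) ≤ 0) :
    (k:ℝ)^2 * ((a:ℝ)^2 + (b:ℝ)^2)^2 ≤ ((a:ℝ)^2 + (b:ℝ)^2)^2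
      + 8 * r * Real.sqrt ((a:ℝ)^2 + (b:ℝ)^2) + 4 := by
  have hbz : (a:ℤ) * Int.gcdA a b + b * Int.gcdB a b = 1 := by
    have := Int.gcd_eq_gcd_ab (a:ℤ) b
    rw [← this]
    simp [hg]
  set h := Int.gcdA a b
  set e := Int.gcdB a b
  have hN : (0:ℝ) < (a:ℝ)^2 + (b:ℝ)^2 := by
    have : a ≠ 0 ∨ b ≠ 0 := by
      by_contra hh
      push Not at hh
      simp [hh.1, hh.2] at hg
    rcases this with h | h
    · have : (0:ℝ) < a := by positivity
      positivity
    · have : (0:ℝ) < b := by positivity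
      positivity
  set N := (a:ℝ)^2 + (b:ℝ)^2 with hNdef
  set A := ((P.1:ℝ) - o1) * a - ((P.2:ℝ) - o2) * b with hA
  set B := ((P.1:ℝ) - o1) * b + ((P.2:ℝ) - o2) * a with hB
  have hbr : (a:ℝ) * h + b * e = 1 := by exact_mod_cast hbz
  set E := (e:ℝ) * a - h * b with hE
  set j : ℤ := - round ((A + E) / N) with hj
  have hjb : |A + E + j * N| ≤ N / 2 := by
    have := abs_sub_round ((A + E) / N)
    have h2 : A + E + j * N = ((A + E) / N - round ((A + E) / N)) * N := by
      rw [hj]; push_cast; field_simp; ring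
    rw [h2, abs_mul, abs_of_pos hN]
    nlinarith
  have hPs : A^2 + B^2 ≤ r^2 * N := by
    have : A^2 + B^2 = (((P.1:ℝ) - o1)^2 + ((P.2:ℝ) - o2)^2) * N := by
      rw [hA, hB, hNdef]; ring
    rw [this]; exact mul_le_mul_of_nonneg_right hP hN.le
  have hQs : (A + k * N)^2 + B^2 ≤ r^2 * N := by
    have hQ' := hQ
    unfold InD at hQ'
    push_cast at hQ'
    have : (A + k * N)^2 + B^2 =
      (((P.1:ℝ) + k * a - o1)^2 + ((P.2:ℝ) - k * b - o2)^2) * N := by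
      rw [hA, hB, hNdef]; ring
    rw [this]; exact mul_le_mul_of_nonneg_right hQ' hN.le
  have hy : ¬ InD o1 o2 r (P.1 + e + j * a, P.2 + h - j * b) := by
    intro hin
    have := hs _ hin
    have h2 : (b:ℤ) * (P.1 + e + j * a - P.1) + a * (P.2 + h - j * b - P.2) = 1 := by
      linear_combination hbz
    simp only at this
    omega
  have hys : r^2 * N < (A + E + j * N)^2 + (B + 1)^2 := by
    unfold InD at hy
    push_cast at hy
    push Not at hy
    have : (A + E + j * N)^2 + (B + 1)^2 =
      (((P.1:ℝ) + e + j * a - o1)^2 + ((P.2:ℝ) + h - j * b - o2)^2) * N := by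
      rw [← hbr, hA, hB, hE, hNdef]; ring
    rw [this]; exact mul_lt_mul_of_pos_right hy hN
  have hsq : (A + E + j * N)^2 ≤ (N/2)^2 := sq_le_sq' (by linarith [(abs_le.1 hjb).1]) (abs_le.1 hjb).2
  have hBle : B ≤ r * Real.sqrt N := by
    refine (abs_le_of_sq_le_sq' ?_ (by positivity)).2
    rw [mul_pow, Real.sq_sqrt hN.le]
    nlinarith [sq_nonneg A]
  nlinarith [sq_nonneg (A + (A + k * N))]

lemma num {r m s k : ℝ} (hr : 0 ≤ r) (hs : 1 ≤ s) (hm : 0 ≤ m) (hm1 : 1 ≤ m)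
    (hsm : s^2 ≤ 2 * m^2)
    (h : k^2 * (m^2)^2 ≤ (m^2)^2 + 8 * r * m + 4) :
    k ≤ 3 + 6 * (Real.sqrt r / (s * Real.sqrt s)) := by
  have hs0 : 0 < s := by linarith
  set t := Real.sqrt r / (s * Real.sqrt s) with ht
  have ht0 : 0 ≤ t := by positivity
  have ht2 : t^2 * s^3 = r := by
    rw [ht, div_pow, mul_pow, Real.sq_sqrt hr, Real.sq_sqrt hs0.le]
    field_simp
  have hm3 : s^3 ≤ 3 * m^3 := by
    have : s ≤ 1.43 * m := by
      refine (abs_le_of_sq_le_sq' ?_ (by positivity)).2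
      nlinarith
    calc s^3 ≤ (1.43 * m)^3 := by gcongr
      _ = 1.43^3 * m^3 := by ring
      _ ≤ 3 * m^3 := by gcongr; norm_num
  have hr2 : r ≤ 3 * t^2 * m^3 := by
    rw [← ht2]; nlinarith [sq_nonneg t]
  have hm4 : (1:ℝ) ≤ (m^2)^2 := by
    have : (1:ℝ) ≤ m^2 := by nlinarith
    nlinarith
  have h2 : k^2 * (m^2)^2 ≤ (5 + 24 * t^2) * (m^2)^2 := by
    have : 8 * r * m ≤ 8 * (3 * t^2 * m^3) * m := by gcongr
    nlinarith
  have h3 : k^2 ≤ 5 + 24 * t^2 := le_of_mul_le_mul_right h2 (by positivity)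
  refine (abs_le_of_sq_le_sq' ?_ (by positivity)).2
  nlinarith

lemma bounded {o1 o2 r : ℝ} (hr : 0 ≤ r) {z : ℤ × ℤ} (hz : InD o1 o2 r z) :
    o1 - r ≤ z.1 ∧ z.1 ≤ o1 + r ∧ o2 - r ≤ z.2 ∧ z.2 ≤ o2 + r := by
  unfold InD at hz
  have h1 := abs_le_of_sq_le_sq' (show ((z.1:ℝ) - o1)^2 ≤ r^2 by nlinarith [sq_nonneg ((z.2:ℝ)-o2)]) hr
  have h2 := abs_le_of_sq_le_sq' (show ((z.2:ℝ) - o2)^2 ≤ r^2 by nlinarith [sq_nonneg ((z.1:ℝ)-o1)]) hr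
  refine ⟨?_, ?_, ?_, ?_⟩ <;> linarith [h1.1, h1.2, h2.1, h2.2]

lemma finD (o1 o2 r : ℝ) (hr : 0 ≤ r) : {z | InD o1 o2 r z}.Finite := by
  apply Set.Finite.subset ((Set.finite_Icc ⌊o1 - r⌋ ⌈o1 + r⌉).prod (Set.finite_Icc ⌊o2 - r⌋ ⌈o2 + r⌉))
  intro z hz
  obtain ⟨h1, h2, h3, h4⟩ := bounded hr hz
  simp only [Set.mem_prod, Set.mem_Icc]
  refine ⟨⟨?_, ?_⟩, ⟨?_, ?_⟩⟩
  · exact_mod_cast (Int.floor_le _).trans h1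
  · exact_mod_cast h2.trans (Int.le_ceil _)
  · exact_mod_cast (Int.floor_le _).trans h3
  · exact_mod_cast h4.trans (Int.le_ceil _)

/-- points of `S` whose successor is at displacement `(a,-b)` -/
def TV (o1 o2 r : ℝ) (a b : ℕ) : Set (ℤ × ℤ) :=
  {z | z ∈ SQ o1 o2 r ∧ (z.1 + (a:ℤ), z.2 - (b:ℤ)) ∈ SQ o1 o2 r ∧
    ∀ w ∈ SQ o1 o2 r, z.1 - z.2 < w.1 - w.2 → z.1 - z.2 + (a + b) ≤ w.1 - w.2}

lemma convD {o1 o2 r : ℝ} {x y z : ℤ × ℤ} {t : ℝ} (h0 : 0 ≤ t) (h1 : t ≤ 1)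
    (hx : InD o1 o2 r x) (hy : InD o1 o2 r y) (e1 : (z.1:ℝ) = x.1 + t * (y.1 - x.1))
    (e2 : (z.2:ℝ) = x.2 + t * (y.2 - x.2)) : InD o1 o2 r z := by
  unfold InD at *
  rw [e1, e2]
  have := mul_nonneg h0 (sub_nonneg.2 h1)
  nlinarith [mul_le_mul_of_nonneg_left hx (sub_nonneg.2 h1), mul_le_mul_of_nonneg_left hy h0,
    mul_nonneg this (sq_nonneg ((y.1:ℝ) - x.1)), mul_nonneg this (sq_nonneg ((y.2:ℝ) - x.2))]

lemma cardTV (o1 o2 r : ℝ) (hr : 0 ≤ r) (a b : ℕ) (hab : 1 ≤ a + b) :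
    ((TV o1 o2 r a b).ncard : ℝ) ≤
      3 + 6 * (Real.sqrt r / (((a + b : ℕ):ℝ) * Real.sqrt ((a + b : ℕ):ℝ))) := by
  have hfin : (TV o1 o2 r a b).Finite := (finD o1 o2 r hr).subset fun z hz => hz.1.1
  by_cases hle : (TV o1 o2 r a b).ncard ≤ 1
  · have h1 : ((TV o1 o2 r a b).ncard : ℝ) ≤ 1 := by exact_mod_cast hle
    have : 0 ≤ Real.sqrt r / (((a + b : ℕ):ℝ) * Real.sqrt ((a + b : ℕ):ℝ)) := by positivity
    linarith
  push Not at hle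
  obtain ⟨x, hx, y, hy, hxy⟩ := (Set.one_lt_ncard hfin).1 hle
  obtain ⟨z, hz, hzmin⟩ := Set.exists_min_image _ (fun z : ℤ × ℤ => z.1 - z.2) hfin ⟨x, hx⟩
  obtain ⟨w, hw, hwmax⟩ := Set.exists_max_image _ (fun z : ℤ × ℤ => z.1 - z.2) hfin ⟨x, hx⟩
  have hinj : ∀ x ∈ SQ o1 o2 r, ∀ y ∈ SQ o1 o2 r, x.1 - x.2 = y.1 - y.2 → x = y := by
    intro x hx y hy h
    have h1 := chain hx hy h.le
    have h2 := chain hy hx h.ge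
    ext <;> omega
  have hzw : z.1 - z.2 < w.1 - w.2 := by
    by_contra hcon
    apply hxy
    apply hinj x hx.1 y hy.1
    have := hzmin x hx; have := hzmin y hy; have := hwmax x hx; have := hwmax y hy
    omega
  have habR : (0:ℝ) < (a:ℝ) + b := by exact_mod_cast hab
  have hl := line hz.1 hz.2.1 hw.1 hw.2.1 hzw.le
  have hlR : (b:ℝ) * (w.1 - z.1) = a * (z.2 - w.2) := by exact_mod_cast hl
  have hzwR : (z.1:ℝ) - z.2 < w.1 - w.2 := by exact_mod_cast hzw
  have hsup := support (t := (((w.1:ℝ) - w.2) - (z.1 - z.2)) / (a + b)) (a := a) (b := b)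
    (div_pos (by linarith) habR) hab hz.1.1 hw.1 hw.2.1.1
    (by field_simp; linear_combination hlR) (by field_simp; linear_combination -hlR)
  -- primitivity
  have hg : Nat.gcd a b = 1 := by
    set g := Nat.gcd a b with hgdef
    have hgpos : 0 < g := Nat.gcd_pos_iff.2 (by omega)
    obtain ⟨a', ha'⟩ := Nat.gcd_dvd_left a b
    obtain ⟨b', hb'⟩ := Nat.gcd_dvd_right a b
    rw [← hgdef] at ha' hb'
    have hgR : (0:ℝ) < g := by exact_mod_cast hgpos
    have haR : (a:ℝ) = g * a' := by exact_mod_cast ha'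
    have hbR : (b:ℝ) = g * b' := by exact_mod_cast hb'
    have hmem : (w.1 + (a':ℤ), w.2 - (b':ℤ)) ∈ SQ o1 o2 r := by
      refine ⟨convD (t := 1 / g) (by positivity) ?_ hw.1.1 hw.2.1.1 ?_ ?_, b, a, by positivity,
        by positivity, by linarith, ?_⟩
      · rw [div_le_one hgR]; exact_mod_cast hgpos
      · push_cast; rw [haR]; field_simp; ring
      · push_cast; rw [hbR]; field_simp; ring
      · intro x hx
        have := hsup x hx
        have h2 : (b:ℝ) * (x.1 - w.1) + a * (x.2 - w.2) ≤ 0 := by exact_mod_cast this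
        push_cast
        have h3 : (b:ℝ) * a' = a * b' := by rw [haR, hbR]; ring
        linarith
    have hpos : 0 < a' + b' := by
      by_contra hcon
      have h1 : a' = 0 := by omega
      have h2 : b' = 0 := by omega
      subst h1; subst h2; omega
    have := hw.2.2 _ hmem (by simp only; omega)
    simp only at this
    have h4 : a + b ≤ a' + b' := by omega
    have h5 : a + b = g * (a' + b') := by rw [mul_add, ← ha', ← hb']
    rw [h5] at h4
    by_contra hne
    have : 2 ≤ g := by omega
    nlinarith
  -- parametrization
  have hpar : ∀ x ∈ TV o1 o2 r a b, ∃ t : ℕ, x = (z.1 + t * (a:ℤ), z.2 - t * (b:ℤ)) := by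
    intro x hx
    have h1 := line hz.1 hz.2.1 hx.1 hx.2.1 (hzmin x hx)
    have hc := chain hz.1 hx.1 (hzmin x hx)
    have hcop : IsCoprime (a:ℤ) (b:ℤ) := Nat.isCoprime_iff_coprime.2 hg
    have hd1 : (a:ℤ) ∣ x.1 - z.1 := hcop.dvd_of_dvd_mul_left ⟨_, h1⟩
    have hd2 : (b:ℤ) ∣ z.2 - x.2 := hcop.symm.dvd_of_dvd_mul_left ⟨_, h1.symm⟩
    obtain ⟨t1, ht1⟩ := hd1
    obtain ⟨t2, ht2⟩ := hd2
    have key : ∃ t : ℤ, x.1 - z.1 = a * t ∧ z.2 - x.2 = b * t := by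
      rcases Nat.eq_zero_or_pos a with h0 | h0
      · refine ⟨t2, ?_, ht2⟩
        rw [ht1, h0]; simp
      rcases Nat.eq_zero_or_pos b with h0' | h0'
      · refine ⟨t1, ht1, ?_⟩
        rw [ht2, h0']; simp
      · refine ⟨t1, ht1, ?_⟩
        rw [ht1, ht2] at h1
        have : t1 = t2 := by
          have hne : ((a:ℤ) * b) ≠ 0 := by positivity
          apply mul_left_cancel₀ hne
          linear_combination h1
        rw [ht2, this]
    obtain ⟨t, h3, h4⟩ := key
    have htn : 0 ≤ t := by
      by_contra hcon
      have h5 : ((a:ℤ) + b) * t < 0 := mul_neg_of_pos_of_neg (by exact_mod_cast hab) (by omega)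
      have : ((a:ℤ) + b) * t = (x.1 - z.1) + (z.2 - x.2) := by rw [h3, h4]; ring
      omega
    lift t to ℕ using htn
    refine ⟨t, ?_⟩
    ext
    · simp only; linarith
    · simp only; linarith
  obtain ⟨k, hk⟩ := hpar w hw
  have hcard : (TV o1 o2 r a b).ncard ≤ k + 1 := by
    have hsub : TV o1 o2 r a b ⊆ ((Finset.range (k+1)).image
        (fun t : ℕ => ((z.1 + t * (a:ℤ), z.2 - t * (b:ℤ)) : ℤ × ℤ)) : Finset (ℤ × ℤ)) := by
      intro x hx
      obtain ⟨t, ht⟩ := hpar x hx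
      have h1 := hwmax x hx
      rw [hk, ht] at h1
      simp only at h1
      have h2 : ((a:ℤ) + b) * t ≤ (a + b) * k := by linarith
      have h3 : (t:ℤ) ≤ k := le_of_mul_le_mul_left h2 (by exact_mod_cast hab)
      simp only [Finset.coe_image, Set.mem_image, Finset.coe_range, Set.mem_Iio]
      exact ⟨t, by omega, ht.symm⟩
    calc _ ≤ _ := Set.ncard_le_ncard hsub (Finset.finite_toSet _)
      _ = _ := Set.ncard_coe_finset _
      _ ≤ _ := Finset.card_image_le
      _ = k + 1 := by simp
  have hch := chord (k := k + 1) hr hg hz.1.1 (by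
    have := hw.2.1.1
    rw [hk] at this
    convert this using 2 <;> push_cast <;> ring) (by
    intro x hx
    have := hsup x hx
    linarith)
  have hN : (0:ℝ) ≤ (a:ℝ)^2 + (b:ℝ)^2 := by positivity
  set m := Real.sqrt ((a:ℝ)^2 + (b:ℝ)^2) with hm
  have hm2 : (a:ℝ)^2 + (b:ℝ)^2 = m^2 := (Real.sq_sqrt hN).symm
  rw [hm2] at hch
  have h1 : (1:ℝ) ≤ (a:ℝ)^2 + (b:ℝ)^2 := by
    have : 1 ≤ a^2 + b^2 := by
      have h1 := Nat.le_self_pow (two_ne_zero) a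
      have h2 := Nat.le_self_pow (two_ne_zero) b
      omega
    exact_mod_cast this
  have := num (s := ((a + b : ℕ):ℝ)) hr (by exact_mod_cast hab) (Real.sqrt_nonneg _)
    (Real.one_le_sqrt.2 h1) (by rw [← hm, ← hm2]; push_cast; nlinarith [sq_nonneg ((a:ℝ) - b)]) hch
  refine le_trans ?_ this
  exact_mod_cast hcard

lemma sum_inv_sqrt (n : ℕ) : ∑ s ∈ Finset.Icc 1 n, 1 / Real.sqrt s ≤ 2 * Real.sqrt n := by
  induction n with
  | zero => simp
  | succ n ih =>
    rw [Finset.sum_Icc_succ_top (by omega)]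
    have h1 : 0 ≤ Real.sqrt (n:ℝ) := Real.sqrt_nonneg _
    have h2 : 0 < Real.sqrt ((n+1:ℕ):ℝ) := Real.sqrt_pos.2 (by positivity)
    have h3 : Real.sqrt (n:ℝ) ^ 2 = n := Real.sq_sqrt (by positivity)
    have h4 : Real.sqrt ((n+1:ℕ):ℝ) ^ 2 = n + 1 := by rw [Real.sq_sqrt (by positivity)]; push_cast; ring
    have : 1 / Real.sqrt ((n+1:ℕ):ℝ) ≤ 2 * Real.sqrt ((n+1:ℕ):ℝ) - 2 * Real.sqrt n := by
      rw [div_le_iff₀ h2]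
      nlinarith [sq_nonneg (Real.sqrt ((n+1:ℕ):ℝ) - Real.sqrt n)]
    linarith

lemma isolated {o1 o2 r : ℝ} (hr : 0 ≤ r) (n : ℕ) :
    (({z | z ∈ SQ o1 o2 r ∧ ∀ w ∈ SQ o1 o2 r, z.1 - z.2 < w.1 - w.2 →
      z.1 - z.2 + n < w.1 - w.2} : Set (ℤ × ℤ)).ncard : ℝ) ≤ 4 * r / (n + 1) + 2 := by
  set L := {z | z ∈ SQ o1 o2 r ∧ ∀ w ∈ SQ o1 o2 r, z.1 - z.2 < w.1 - w.2 →
      z.1 - z.2 + n < w.1 - w.2} with hL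
  set c := o1 - o2 with hc
  have hn : (0:ℝ) < (n:ℝ) + 1 := by positivity
  set lo : ℤ := ⌊(c - 2 * r) / (n + 1)⌋
  set hi : ℤ := ⌊(c + 2 * r) / (n + 1)⌋
  have hle : L.ncard ≤ (Finset.Icc lo hi : Set ℤ).ncard := by
    apply Set.ncard_le_ncard_of_injOn (fun z : ℤ × ℤ => (⌊((z.1:ℝ) - z.2) / (n + 1)⌋ : ℤ))
    · intro z hz
      obtain ⟨h1, h2, h3, h4⟩ := bounded hr hz.1.1
      simp only [Finset.coe_Icc, Set.mem_Icc]
      constructor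
      · apply Int.floor_le_floor
        apply div_le_div_of_nonneg_right _ hn.le
        linarith
      · apply Int.floor_le_floor
        apply div_le_div_of_nonneg_right _ hn.le
        linarith
    · have key : ∀ z ∈ L, ∀ w ∈ L, z.1 - z.2 < w.1 - w.2 →
          ⌊((z.1:ℝ) - z.2) / (n + 1)⌋ < ⌊((w.1:ℝ) - w.2) / (n + 1)⌋ := by
        intro z hz w hw hlt
        have h1 := hz.2 w hw.1 hlt
        have h2 : z.1 - z.2 + (n + 1) ≤ w.1 - w.2 := by omega
        have h3 : (z.1:ℝ) - z.2 + (n + 1) ≤ w.1 - w.2 := by exact_mod_cast h2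
        have h4 : ((z.1:ℝ) - z.2) / (n + 1) + 1 ≤ ((w.1:ℝ) - w.2) / (n + 1) := by
          rw [div_add_one hn.ne']; gcongr
        have h5 := Int.floor_le_floor h4
        rw [Int.floor_add_one] at h5
        omega
      intro z hz w hw heq
      simp only at heq
      rcases lt_trichotomy (z.1 - z.2) (w.1 - w.2) with h | h | h
      · have := key z hz w hw h; omega
      · have h1 := chain hz.1 hw.1 h.le
        have h2 := chain hw.1 hz.1 h.ge
        ext <;> omega
      · have := key w hw z hz h; omega
  rw [Set.ncard_coe_finset, Int.card_Icc] at hle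
  have h1 : ((hi + 1 - lo).toNat : ℝ) ≤ 4 * r / (n + 1) + 2 := by
    have h2 : (hi:ℝ) ≤ (c + 2 * r) / (n + 1) := Int.floor_le _
    have h3 : (c - 2 * r) / (n + 1) < (lo:ℝ) + 1 := Int.lt_floor_add_one _
    have h4 : (c + 2 * r) / (n + 1) = (c - 2 * r) / (n + 1) + 4 * r / (n + 1) := by
      rw [← add_div]; ring
    have h5 : (0:ℝ) ≤ 4 * r / (n + 1) := by positivity
    have h6 : ((hi + 1 - lo).toNat : ℝ) = ((max (hi + 1 - lo) 0 : ℤ) : ℝ) := by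
      rw [← Int.toNat_eq_max, Int.cast_natCast]
    rw [h6]
    push_cast
    apply max_le <;> linarith
  exact le_trans (by exact_mod_cast hle) h1

open Classical in
lemma quad (o1 o2 G : ℝ) (hG : 1 ≤ G) : ((SQ o1 o2 (G^3)).ncard : ℝ) ≤ 40 * G^2 := by
  set r := G^3 with hrdef
  have hr : 0 ≤ r := by positivity
  set n := ⌊G⌋₊ with hn
  have hnG : (n:ℝ) ≤ G := Nat.floor_le (by linarith)
  have hGn : G < n + 1 := Nat.lt_floor_add_one _
  have hfin : (SQ o1 o2 r).Finite := (finD o1 o2 r hr).subset fun z hz => hz.1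
  have hTfin : ∀ a b, (TV o1 o2 r a b).Finite := fun a b =>
    (finD o1 o2 r hr).subset fun z hz => hz.1.1
  set L := {z | z ∈ SQ o1 o2 r ∧ ∀ w ∈ SQ o1 o2 r, z.1 - z.2 < w.1 - w.2 →
      z.1 - z.2 + n < w.1 - w.2} with hL
  have hLfin : L.Finite := hfin.subset fun z hz => hz.1
  have hLc : (L.ncard : ℝ) ≤ 4 * r / (n + 1) + 2 := isolated hr n
  have hLc' : (L.ncard : ℝ) ≤ 6 * G^2 := by
    have : 4 * r / (n + 1) ≤ 4 * G^2 := by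
      rw [div_le_iff₀ (by positivity), hrdef]
      nlinarith [sq_nonneg G, mul_nonneg (sq_nonneg G) (sub_nonneg.2 hGn.le)]
    nlinarith
  set B : Finset (ℤ × ℤ) := (Finset.Icc 1 n).biUnion fun s =>
    (Finset.range (s+1)).biUnion fun a => (hTfin a (s - a)).toFinset with hB
  have hcov : hfin.toFinset ⊆ hLfin.toFinset ∪ B := by
    intro z hz
    rw [Set.Finite.mem_toFinset] at hz
    by_cases hzL : z ∈ L
    · exact Finset.mem_union_left _ (by simpa using hzL)
    apply Finset.mem_union_right
    have : ∃ w ∈ SQ o1 o2 r, z.1 - z.2 < w.1 - w.2 ∧ w.1 - w.2 ≤ z.1 - z.2 + n := by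
      by_contra hcon
      push Not at hcon
      exact hzL ⟨hz, hcon⟩
    obtain ⟨w0, hw0, h1, h2⟩ := this
    obtain ⟨w, ⟨hw, hzw⟩, hwmin⟩ := Set.exists_min_image
      {w | w ∈ SQ o1 o2 r ∧ z.1 - z.2 < w.1 - w.2} (fun w : ℤ × ℤ => w.1 - w.2)
      (hfin.subset fun z hz => hz.1) ⟨w0, hw0, h1⟩
    have h3 := hwmin w0 ⟨hw0, h1⟩
    have hc := chain hz hw hzw.le
    obtain ⟨a, ha⟩ := Int.eq_ofNat_of_zero_le (sub_nonneg.2 hc.1)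
    obtain ⟨b, hb⟩ := Int.eq_ofNat_of_zero_le (sub_nonneg.2 hc.2)
    simp only [hB, Finset.mem_biUnion, Finset.mem_Icc, Finset.mem_range, Set.Finite.mem_toFinset]
    refine ⟨a + b, by omega, a, by omega, ?_⟩
    rw [Nat.add_sub_cancel_left]
    refine ⟨hz, ?_, ?_⟩
    · have : (z.1 + (a:ℤ), z.2 - (b:ℤ)) = w := by ext <;> simp only <;> omega
      rw [this]; exact hw
    · intro w' hw' hlt
      have := hwmin w' ⟨hw', hlt⟩
      omega
  have hcard : (SQ o1 o2 r).ncard ≤ L.ncard + B.card := by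
    rw [Set.ncard_eq_toFinset_card _ hfin, Set.ncard_eq_toFinset_card _ hLfin]
    exact (Finset.card_le_card hcov).trans (Finset.card_union_le _ _)
  have hBc : (B.card : ℝ) ≤ ∑ s ∈ Finset.Icc 1 n, (6 * G + 12 * Real.sqrt r * (1 / Real.sqrt s)) := by
    have h1 : B.card ≤ ∑ s ∈ Finset.Icc 1 n, ((Finset.range (s+1)).biUnion
      fun a => (hTfin a (s - a)).toFinset).card := Finset.card_biUnion_le
    have h2 : (B.card : ℝ) ≤ ∑ s ∈ Finset.Icc 1 n, (((Finset.range (s+1)).biUnion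
      fun a => (hTfin a (s - a)).toFinset).card : ℝ) := by exact_mod_cast h1
    refine h2.trans (Finset.sum_le_sum ?_)
    intro s hs
    rw [Finset.mem_Icc] at hs
    have h3 : ((Finset.range (s+1)).biUnion fun a => (hTfin a (s - a)).toFinset).card ≤
      ∑ a ∈ Finset.range (s+1), (hTfin a (s - a)).toFinset.card := Finset.card_biUnion_le
    have h4 : (((Finset.range (s+1)).biUnion fun a => (hTfin a (s - a)).toFinset).card : ℝ) ≤
      ∑ a ∈ Finset.range (s+1), ((hTfin a (s - a)).toFinset.card : ℝ) := by exact_mod_cast h3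
    have h5 : ∑ a ∈ Finset.range (s+1), ((hTfin a (s - a)).toFinset.card : ℝ) ≤
      ∑ a ∈ Finset.range (s+1), (3 + 6 * (Real.sqrt r / ((s:ℝ) * Real.sqrt s))) := by
      apply Finset.sum_le_sum
      intro a ha
      rw [Finset.mem_range] at ha
      have e : a + (s - a) = s := by omega
      have := cardTV o1 o2 r hr a (s - a) (by omega)
      rw [e, Set.ncard_eq_toFinset_card _ (hTfin a (s - a))] at this
      exact this
    refine h4.trans (h5.trans ?_)
    rw [Finset.sum_const, Finset.card_range, nsmul_eq_mul]
    have hs1 : (1:ℝ) ≤ s := by exact_mod_cast hs.1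
    have hsn : (s:ℝ) ≤ n := by exact_mod_cast hs.2
    have hq : 0 < Real.sqrt (s:ℝ) := Real.sqrt_pos.2 (by linarith)
    have hx : 0 ≤ Real.sqrt r / ((s:ℝ) * Real.sqrt s) := by positivity
    have hx2 : Real.sqrt r * (1 / Real.sqrt s) = s * (Real.sqrt r / ((s:ℝ) * Real.sqrt s)) := by
      field_simp
    have : 12 * Real.sqrt r * (1 / Real.sqrt s) = 12 * (s * (Real.sqrt r / ((s:ℝ) * Real.sqrt s))) := by
      rw [← hx2]; ring
    rw [this]
    push_cast
    nlinarith [mul_nonneg (sub_nonneg.2 hs1) hx]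
  have hsum : ∑ s ∈ Finset.Icc 1 n, (6 * G + 12 * Real.sqrt r * (1 / Real.sqrt (s:ℝ))) ≤ 30 * G^2 := by
    rw [Finset.sum_add_distrib, ← Finset.mul_sum (Finset.Icc 1 n) (fun s : ℕ => 1 / Real.sqrt (s:ℝ)), Finset.sum_const, Nat.card_Icc, nsmul_eq_mul]
    have h1 := sum_inv_sqrt n
    have h2 : Real.sqrt r * Real.sqrt n ≤ G^2 := by
      rw [← Real.sqrt_mul hr]
      apply Real.sqrt_le_iff.2
      refine ⟨by positivity, ?_⟩
      rw [hrdef]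
      nlinarith [mul_le_mul_of_nonneg_left hnG (show 0 ≤ G^3 by positivity)]
    have h3 : 12 * Real.sqrt r * ∑ s ∈ Finset.Icc 1 n, 1 / Real.sqrt (s:ℝ) ≤
      12 * Real.sqrt r * (2 * Real.sqrt n) := mul_le_mul_of_nonneg_left h1 (by positivity)
    have h4 : (n:ℝ) * (6 * G) ≤ 6 * G^2 := by nlinarith
    simp only [Nat.add_sub_cancel]
    linarith
  have : ((SQ o1 o2 r).ncard : ℝ) ≤ L.ncard + B.card := by exact_mod_cast hcard
  nlinarith [sq_nonneg G]

lemma embed0 (z : ℤ × ℤ) : latticeEmbed z 0 = z.1 := by simp [latticeEmbed]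
lemma embed1 (z : ℤ × ℤ) : latticeEmbed z 1 = z.2 := by simp [latticeEmbed]

lemma mem_ball_iff (o : EuclideanSpace ℝ (Fin 2)) (r : ℝ) (hr : 0 ≤ r) (z : ℤ × ℤ) :
    latticeEmbed z ∈ Metric.closedBall o r ↔ InD (o 0) (o 1) r z := by
  rw [Metric.mem_closedBall, EuclideanSpace.dist_eq, Fin.sum_univ_two, Real.sqrt_le_left hr,
    Real.dist_eq, Real.dist_eq, sq_abs, sq_abs, embed0, embed1]
  rfl

lemma functional (f : EuclideanSpace ℝ (Fin 2) →ₗ[ℝ] ℝ) (x : EuclideanSpace ℝ (Fin 2)) :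
    f x = f (latticeEmbed (1, 0)) * x 0 + f (latticeEmbed (0, 1)) * x 1 := by
  have : x = x 0 • latticeEmbed (1, 0) + x 1 • latticeEmbed (0, 1) := by
    ext i
    fin_cases i <;> simp [latticeEmbed]
  conv_lhs => rw [this]
  simp [mul_comm]

lemma exists_support {s : Set (EuclideanSpace ℝ (Fin 2))} (hs : Convex ℝ s)
    {x : EuclideanSpace ℝ (Fin 2)} (hx : x ∈ s) (hxi : x ∉ interior s) :
    ∃ f : EuclideanSpace ℝ (Fin 2) →ₗ[ℝ] ℝ, f ≠ 0 ∧ ∀ a ∈ s, f a ≤ f x := by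
  by_cases hne : (interior s).Nonempty
  · obtain ⟨f, hf, h⟩ := geometric_hahn_banach_of_nonempty_interior_point hs hxi hne
    refine ⟨f, ?_, h⟩
    intro h0
    apply hf
    ext y
    exact congrArg (fun g => g y) h0
  · rw [hs.interior_nonempty_iff_affineSpan_eq_top] at hne
    have hne2 : (affineSpan ℝ s : Set (EuclideanSpace ℝ (Fin 2))).Nonempty :=
      ⟨x, subset_affineSpan ℝ s hx⟩
    have hd : (affineSpan ℝ s).direction < ⊤ := by
      rw [lt_top_iff_ne_top]
      intro h
      exact hne ((AffineSubspace.direction_eq_top_iff_of_nonempty hne2).1 h)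
    obtain ⟨f, hf, hk⟩ := Submodule.exists_le_ker_of_lt_top _ hd
    refine ⟨f, hf, fun a ha => ?_⟩
    have := hk (AffineSubspace.vsub_mem_direction (subset_affineSpan ℝ s ha)
      (subset_affineSpan ℝ s hx))
    rw [LinearMap.mem_ker, vsub_eq_sub, map_sub] at this
    linarith

/-- reflections of the lattice -/
def refl (s t : ℤ) (z : ℤ × ℤ) : ℤ × ℤ := (s * z.1, t * z.2)

lemma refl_inD {o1 o2 r : ℝ} {s t : ℤ} (hs : s * s = 1) (ht : t * t = 1) (z : ℤ × ℤ) :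
    InD (s * o1) (t * o2) r (refl s t z) ↔ InD o1 o2 r z := by
  have hs' : (s:ℝ) * s = 1 := by exact_mod_cast hs
  have ht' : (t:ℝ) * t = 1 := by exact_mod_cast ht
  unfold InD refl
  push_cast
  have : ((s:ℝ) * z.1 - s * o1)^2 + ((t:ℝ) * z.2 - t * o2)^2 
      = ((z.1:ℝ) - o1)^2 + ((z.2:ℝ) - o2)^2 := by
    linear_combination ((z.1:ℝ) - o1)^2 * hs' + ((z.2:ℝ) - o2)^2 * ht'
  rw [this]

lemma refl_refl {s t : ℤ} (hs : s * s = 1) (ht : t * t = 1) (z : ℤ × ℤ) :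
    refl s t (refl s t z) = z := by
  unfold refl
  ext
  · simp only; rw [← mul_assoc, hs, one_mul]
  · simp only; rw [← mul_assoc, ht, one_mul]

lemma mem_refl {o1 o2 r : ℝ} {s t : ℤ} (hs : s * s = 1) (ht : t * t = 1) {z : ℤ × ℤ}
    (hz : InD o1 o2 r z) {p q : ℝ} (hp : 0 ≤ s * p) (hq : 0 ≤ t * q) (hpq : p ≠ 0 ∨ q ≠ 0)
    (H : ∀ x, InD o1 o2 r x → p * ((x.1:ℝ) - z.1) + q * ((x.2:ℝ) - z.2) ≤ 0) :
    z ∈ Set.image (refl s t) (SQ (s * o1) (t * o2) r) := by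
  have hs' : (s:ℝ) * s = 1 := by exact_mod_cast hs
  have ht' : (t:ℝ) * t = 1 := by exact_mod_cast ht
  refine ⟨refl s t z, ⟨(refl_inD hs ht z).2 hz, s * p, t * q, hp, hq, ?_, ?_⟩, refl_refl hs ht z⟩
  · have hs0 : (s:ℝ) ≠ 0 := by intro h; simp [h] at hs'
    have ht0 : (t:ℝ) ≠ 0 := by intro h; simp [h] at ht'
    rcases hpq with h | h
    · have := lt_of_le_of_ne hp (mul_ne_zero hs0 h).symm
      linarith
    · have := lt_of_le_of_ne hq (mul_ne_zero ht0 h).symm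
      linarith
  · intro x hx
    rw [← refl_refl hs ht x, refl_inD hs ht] at hx
    have := H _ hx
    unfold refl at this ⊢
    push_cast at this ⊢
    have e : (s:ℝ) * p * (x.1 - s * z.1) + t * q * (x.2 - t * z.2)
        = p * (s * x.1 - z.1) + q * (t * x.2 - z.2) := by
      linear_combination (-p * z.1) * hs' + (-q * z.2) * ht'
    rw [e]; exact this

end DiscHull

open DiscHull in
/-- There is an absolute constant `K` such that for every closed disk `D` of
radius `r > 1` in the plane, the number of lattice points on the boundary of
the convex hull of `D ∩ ℤ²` is at most `K · r^{2/3}`. -/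
theorem stmt9 : ∃ K : ℝ, ∀ (o : EuclideanSpace ℝ (Fin 2)) (r : ℝ), 1 < r →
    ((Set.ncard {z : ℤ × ℤ | latticeEmbed z ∈
        frontier (convexHull ℝ (Metric.closedBall o r ∩ Set.range latticeEmbed))}) : ℝ)
      ≤ K * r ^ ((2:ℝ)/3) := by
  refine ⟨160, fun o r hr => ?_⟩
  have hr0 : 0 ≤ r := by linarith
  set G := r ^ ((1:ℝ)/3) with hG
  have hG1 : 1 ≤ G := Real.one_le_rpow hr.le (by norm_num)
  have hG3 : G ^ 3 = r := by
    rw [hG, ← Real.rpow_natCast, ← Real.rpow_mul hr0]; norm_num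
  have hG2 : r ^ ((2:ℝ)/3) = G ^ 2 := by
    rw [hG, ← Real.rpow_natCast, ← Real.rpow_mul hr0]; norm_num
  rw [hG2]
  set o1 := o 0
  set o2 := o 1
  let T : ℤ → ℤ → Set (ℤ × ℤ) := fun s t => Set.image (refl s t) (SQ (s * o1) (t * o2) r)
  have hSfin : ∀ o1 o2 : ℝ, (SQ o1 o2 r).Finite := fun o1 o2 =>
    (finD o1 o2 r hr0).subset fun z hz => hz.1
  have hTfin : ∀ s t, (T s t).Finite := fun s t => (hSfin _ _).image _
  have hTc : ∀ s t, ((T s t).ncard : ℝ) ≤ 40 * G^2 := by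
    intro s t
    have h1 : (T s t).ncard ≤ (SQ (s * o1) (t * o2) r).ncard := Set.ncard_image_le (hSfin _ _)
    have h2 := quad (s * o1) (t * o2) G hG1
    rw [hG3] at h2
    exact le_trans (by exact_mod_cast h1) h2
  set A := Metric.closedBall o r ∩ Set.range latticeEmbed with hA
  have hAfin : A.Finite := by
    apply ((finD o1 o2 r hr0).image latticeEmbed).subset
    rintro _ ⟨h1, z, rfl⟩
    exact ⟨z, (mem_ball_iff o r hr0 z).1 h1, rfl⟩
  have hcl : IsClosed (convexHull ℝ A) := hAfin.isClosed_convexHull ℝ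
  have hsub : {z : ℤ × ℤ | latticeEmbed z ∈ frontier (convexHull ℝ A)} ⊆
      (T 1 1 ∪ T 1 (-1)) ∪ (T (-1) 1 ∪ T (-1) (-1)) := by
    intro z hz
    rw [Set.mem_ofPred_eq, hcl.frontier_eq] at hz
    obtain ⟨hz1, hz2⟩ := hz
    have hzD : InD o1 o2 r z := by
      rw [← mem_ball_iff o r hr0]
      exact convexHull_min Set.inter_subset_left (convex_closedBall o r) hz1
    obtain ⟨f, hf, H⟩ := exists_support (convex_convexHull ℝ A) hz1 hz2
    set p := f (latticeEmbed (1, 0)) with hp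
    set q := f (latticeEmbed (0, 1)) with hq
    have hpq : p ≠ 0 ∨ q ≠ 0 := by
      by_contra hcon
      push Not at hcon
      apply hf
      ext1 x
      rw [functional f x, ← hp, ← hq, hcon.1, hcon.2]
      simp
    have H' : ∀ x, InD o1 o2 r x → p * ((x.1:ℝ) - z.1) + q * ((x.2:ℝ) - z.2) ≤ 0 := by
      intro x hx
      have := H (latticeEmbed x) (subset_convexHull ℝ A ⟨(mem_ball_iff o r hr0 x).2 hx, x, rfl⟩)
      rw [functional f (latticeEmbed x), functional f (latticeEmbed z), embed0, embed1, embed0,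
        embed1, ← hp, ← hq] at this
      linarith
    rcases le_total 0 p with h1 | h1 <;> rcases le_total 0 q with h2 | h2
    · exact Or.inl (Or.inl (mem_refl (by norm_num) (by norm_num) hzD (by simpa using h1)
        (by simpa using h2) hpq H'))
    · exact Or.inl (Or.inr (mem_refl (by norm_num) (by norm_num) hzD (by simpa using h1)
        (by simpa using h2) hpq H'))
    · exact Or.inr (Or.inl (mem_refl (by norm_num) (by norm_num) hzD (by simpa using h1)
        (by simpa using h2) hpq H'))
    · exact Or.inr (Or.inr (mem_refl (by norm_num) (by norm_num) hzD (by simpa using h1)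
        (by simpa using h2) hpq H'))
  have hc := Set.ncard_le_ncard hsub
    (((hTfin _ _).union (hTfin _ _)).union ((hTfin _ _).union (hTfin _ _)))
  have h1 := Set.ncard_union_le (T 1 1 ∪ T 1 (-1)) (T (-1) 1 ∪ T (-1) (-1))
  have h2 := Set.ncard_union_le (T 1 1) (T 1 (-1))
  have h3 := Set.ncard_union_le (T (-1) 1) (T (-1) (-1))
  have h4 : {z : ℤ × ℤ | latticeEmbed z ∈ frontier (convexHull ℝ A)}.ncard ≤
    (T 1 1).ncard + (T 1 (-1)).ncard + ((T (-1) 1).ncard + (T (-1) (-1)).ncard) := by omega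
  have h5 : ({z : ℤ × ℤ | latticeEmbed z ∈ frontier (convexHull ℝ A)}.ncard : ℝ) ≤
    (T 1 1).ncard + (T 1 (-1)).ncard + ((T (-1) 1).ncard + (T (-1) (-1)).ncard) := by
    exact_mod_cast h4
  linarith [hTc 1 1, hTc 1 (-1), hTc (-1) 1, hTc (-1) (-1)]
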